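/- arXiv:1505.07623 — 6 statements merged into one kernel-verified Lean document; each statement's English description precedes it below -/
import Mathlib

section
/- Let p > 1 and m > 1 be real numbers and let 0 ≤ λ ≤ ((m−1)/p)^p. Then the equation (p−1)y^p − (m−1)y^{p−1} + λ = 0 has exactly one solution y in the interval [(m−1)/p, (m−1)/(p−1)]. Moreover, every positive solution y > 0 of this equation satisfies y ≤ (m−1)/(p−1). -/
theorem Real.strictMonoOn_sub_mul_rpow {p c : ℝ} (hp : 1 < p) (hc : 0 < c) :
    StrictMonoOn (fun y : ℝ => (p - 1) * y ^ p - c * y ^ (p - 1)) (Set.Ici (c / p)) := by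
  have hp0 : 0 < p := by linarith
  have ha : 0 < c / p := div_pos hc hp0
  refine strictMonoOn_of_deriv_pos (convex_Ici _) ?_ ?_
  · exact ((continuous_const.mul (Real.continuous_rpow_const hp0.le)).sub
      (continuous_const.mul (Real.continuous_rpow_const (sub_pos.2 hp).le))).continuousOn
  · intro x hx
    rw [interior_Ici, Set.mem_Ioi] at hx
    have hx0 : 0 < x := ha.trans hx
    have hd := ((Real.hasDerivAt_rpow_const (x := x) (p := p) (Or.inl hx0.ne')).const_mul
      (p - 1)).sub ((Real.hasDerivAt_rpow_const (x := x) (p := p - 1)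
        (Or.inl hx0.ne')).const_mul c)
    have hd' := hd.deriv
    have hpow : x ^ (p - 1) = x ^ (p - 1 - 1) * x := by
      rw [← Real.rpow_add_one hx0.ne', sub_add_cancel]
    have hpos : 0 < (p - 1) * x ^ (p - 1 - 1) * (x * p - c) :=
      mul_pos (mul_pos (by linarith) (Real.rpow_pos_of_pos hx0 _))
        (sub_pos.2 ((div_lt_iff₀ hp0).1 hx))
    refine lt_of_lt_of_eq hpos (Eq.trans ?_ hd'.symm)
    rw [hpow]
    ring

theorem Real.sub_mul_rpow_eq_rpow_mul {p c y : ℝ} (hy : 0 < y) :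
    (p - 1) * y ^ p - c * y ^ (p - 1) = y ^ (p - 1) * ((p - 1) * y - c) := by
  have hpow : y ^ p = y ^ (p - 1) * y := by
    rw [← Real.rpow_add_one hy.ne', sub_add_cancel]
  rw [hpow]
  ring

/-- For `p > 1`, `m > 1` and `0 ≤ λ ≤ ((m-1)/p)^p`, the equation
`(p-1)y^p - (m-1)y^(p-1) + λ = 0` has exactly one solution in the interval
`[(m-1)/p, (m-1)/(p-1)]`; moreover every positive solution satisfies
`y ≤ (m-1)/(p-1)`. -/
theorem eigen_polynomial_root (p m lam : ℝ) (hp : 1 < p) (hm : 1 < m)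
    (hlam0 : 0 ≤ lam) (hlam : lam ≤ ((m - 1) / p) ^ p) :
    (∃! y : ℝ, y ∈ Set.Icc ((m - 1) / p) ((m - 1) / (p - 1)) ∧
        (p - 1) * y ^ p - (m - 1) * y ^ (p - 1) + lam = 0) ∧
    (∀ y : ℝ, 0 < y → (p - 1) * y ^ p - (m - 1) * y ^ (p - 1) + lam = 0 →
        y ≤ (m - 1) / (p - 1)) := by
  have hp0 : 0 < p := by linarith
  have hp1 : 0 < p - 1 := by linarith
  have hc : 0 < m - 1 := by linarith
  have ha : 0 < (m - 1) / p := div_pos hc hp0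
  have hb : 0 < (m - 1) / (p - 1) := div_pos hc hp1
  have hab : (m - 1) / p ≤ (m - 1) / (p - 1) :=
    div_le_div_of_nonneg_left hc.le hp1 (by linarith)
  have hmono := Real.strictMonoOn_sub_mul_rpow hp hc
  refine ⟨?_, ?_⟩
  · have hcont : ContinuousOn (fun y : ℝ => (p - 1) * y ^ p - (m - 1) * y ^ (p - 1))
        (Set.Icc ((m - 1) / p) ((m - 1) / (p - 1))) :=
      ((continuous_const.mul (Real.continuous_rpow_const hp0.le)).sub
        (continuous_const.mul (Real.continuous_rpow_const hp1.le))).continuousOn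
    have hleft : (p - 1) * ((m - 1) / p) ^ p - (m - 1) * ((m - 1) / p) ^ (p - 1) ≤ -lam := by
      have hpow : ((m - 1) / p) ^ p = ((m - 1) / p) ^ (p - 1) * ((m - 1) / p) := by
        rw [← Real.rpow_add_one ha.ne', sub_add_cancel]
      have hlin : (p - 1) * ((m - 1) / p) - (m - 1) = -((m - 1) / p) := by
        field_simp
        ring
      rw [Real.sub_mul_rpow_eq_rpow_mul ha, hlin, mul_neg, ← hpow]
      linarith
    have hright : -lam ≤ (p - 1) * ((m - 1) / (p - 1)) ^ p
        - (m - 1) * ((m - 1) / (p - 1)) ^ (p - 1) := by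
      rw [Real.sub_mul_rpow_eq_rpow_mul hb, mul_div_cancel₀ _ hp1.ne', sub_self, mul_zero]
      linarith
    obtain ⟨y, hy, hfy⟩ := intermediate_value_Icc hab hcont ⟨hleft, hright⟩
    dsimp only at hfy
    refine ⟨y, ⟨hy, by linarith⟩, ?_⟩
    rintro z ⟨hz, hfz⟩
    exact hmono.injOn hz.1 hy.1 (by linarith)
  · intro y hy hfy
    by_contra! hlt
    rw [Real.sub_mul_rpow_eq_rpow_mul hy] at hfy
    have hpos : 0 < y ^ (p - 1) * ((p - 1) * y - (m - 1)) :=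
      mul_pos (Real.rpow_pos_of_pos hy _) (by rw [div_lt_iff₀ hp1] at hlt; linarith)
    linarith
end

section
/- Let p > 1 and m > 1 be real numbers and set x* = ((p−1)(m−1)/p)². Then the function φ(t) = t^{p/2} − (m−1)t^{(p−1)/2} is strictly increasing on [x*, ∞), and for each real λ with 0 < λ ≤ ((m−1)/p)^p the equation t^{p/2} − (m−1)t^{(p−1)/2} + λ(p−1)^{p−1} = 0 has exactly one solution x in [x*, ∞). In particular this solution satisfies x ≥ (p−1)²((m−1)/p)². -/
open Set in
/-- For `p > 1`, the function `s ↦ s ^ p - c * s ^ (p - 1)` is strictly increasing to the right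
of its critical point `(p - 1) * c / p`. -/
theorem strictMonoOn_rpow_sub_const_mul_rpow {p c : ℝ} (hp : 1 < p) (hc : 0 < c) :
    StrictMonoOn (fun s : ℝ => s ^ p - c * s ^ (p - 1)) (Ici ((p - 1) * c / p)) := by
  have hp0 : 0 < p := by linarith
  have hs0 : 0 < (p - 1) * c / p := div_pos (mul_pos (by linarith) hc) hp0
  have hd : ∀ s ∈ Ici ((p - 1) * c / p), HasDerivAt (fun s : ℝ => s ^ p - c * s ^ (p - 1))
      (p * s ^ (p - 1) - c * ((p - 1) * s ^ (p - 1 - 1))) s := fun s hs =>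
    have hs : s ≠ 0 := (hs0.trans_le hs).ne'
    (Real.hasDerivAt_rpow_const (Or.inl hs)).sub
      ((Real.hasDerivAt_rpow_const (Or.inl hs)).const_mul c)
  refine strictMonoOn_of_deriv_pos (convex_Ici _)
    (fun s hs => (hd s hs).continuousAt.continuousWithinAt) fun s hs => ?_
  rw [interior_Ici] at hs
  have hs_pos : 0 < s := hs0.trans hs
  rw [(hd s (Ioi_subset_Ici_self hs)).deriv,
    show s ^ (p - 1) = s ^ (p - 1 - 1) * s by
      rw [← Real.rpow_add_one hs_pos.ne', sub_add_cancel]]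
  have h1 : (p - 1) * c < s * p := (div_lt_iff₀ hp0).1 hs
  have h2 := mul_pos (Real.rpow_pos_of_pos hs_pos (p - 1 - 1)) (sub_pos.2 h1)
  linarith


/-- For `p > 1`, `m > 1` and `x* = ((p-1)(m-1)/p)²`, the function
`φ(t) = t^(p/2) - (m-1) t^((p-1)/2)` is strictly increasing on `[x*, ∞)`, and for
each `0 < λ ≤ ((m-1)/p)^p` the equation `t^(p/2) - (m-1)t^((p-1)/2) + λ(p-1)^(p-1) = 0`
has exactly one solution in `[x*, ∞)` (so in particular this solution `x` satisfies
`x ≥ (p-1)²((m-1)/p)²`). -/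
theorem eigen_equation_unique_root (p m : ℝ) (hp : 1 < p) (hm : 1 < m) :
    StrictMonoOn (fun t : ℝ => t ^ (p / 2) - (m - 1) * t ^ ((p - 1) / 2))
      (Set.Ici (((p - 1) * (m - 1) / p) ^ 2)) ∧
    ∀ lam : ℝ, 0 < lam → lam ≤ ((m - 1) / p) ^ p →
      ∃! x : ℝ, x ∈ Set.Ici (((p - 1) * (m - 1) / p) ^ 2) ∧
        x ^ (p / 2) - (m - 1) * x ^ ((p - 1) / 2) + lam * (p - 1) ^ (p - 1) = 0 := by
  set a := (m - 1) / p with ha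
  have hp0 : 0 < p := by linarith
  have hm0 : 0 < m - 1 := by linarith
  have ha0 : 0 < a := div_pos hm0 hp0
  have hma : m - 1 = p * a := by rw [ha]; field_simp
  have hs : (p - 1) * (m - 1) / p = (p - 1) * a := by rw [ha, mul_div_assoc]
  have hs0 : 0 < (p - 1) * a := mul_pos (by linarith) ha0
  have hφ : ∀ t : ℝ, 0 ≤ t → t ^ (p / 2) - (m - 1) * t ^ ((p - 1) / 2) =
      √t ^ p - (m - 1) * √t ^ (p - 1) := fun t ht => by
    rw [Real.rpow_div_two_eq_sqrt _ ht, Real.rpow_div_two_eq_sqrt _ ht]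
  have hmono : StrictMonoOn (fun t : ℝ => t ^ (p / 2) - (m - 1) * t ^ ((p - 1) / 2))
      (Set.Ici (((p - 1) * (m - 1) / p) ^ 2)) := by
    intro x hx y hy hxy
    have hx0 : 0 ≤ x := (sq_nonneg _).trans hx
    have hy0 : 0 ≤ y := (sq_nonneg _).trans hy
    simp only [hφ x hx0, hφ y hy0]
    exact strictMonoOn_rpow_sub_const_mul_rpow hp hm0 (Real.le_sqrt_of_sq_le hx)
      (Real.le_sqrt_of_sq_le hy) (Real.sqrt_lt_sqrt hx0 hxy)
  refine ⟨hmono, fun lam hlam hle => ?_⟩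
  have hq : 0 < (p - 1) ^ (p - 1) := Real.rpow_pos_of_pos (by linarith) _
  have hleft : (((p - 1) * (m - 1) / p) ^ 2) ^ (p / 2) -
      (m - 1) * (((p - 1) * (m - 1) / p) ^ 2) ^ ((p - 1) / 2) = -(a ^ p * (p - 1) ^ (p - 1)) := by
    have hpow : ∀ s : ℝ, 0 < s → s ^ p = s ^ (p - 1) * s := fun s hs => by
      rw [← Real.rpow_add_one hs.ne', sub_add_cancel]
    rw [hφ _ (sq_nonneg _), hs, Real.sqrt_sq hs0.le, hpow _ hs0, hpow _ ha0,
      Real.mul_rpow (by linarith) ha0.le, hma]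
    ring
  have hright : ((m - 1) ^ 2) ^ (p / 2) - (m - 1) * ((m - 1) ^ 2) ^ ((p - 1) / 2) = 0 := by
    rw [hφ _ (sq_nonneg _), Real.sqrt_sq hm0.le, mul_comm, ← Real.rpow_add_one hm0.ne',
      sub_add_cancel, sub_self]
  have hab : ((p - 1) * (m - 1) / p) ^ 2 ≤ (m - 1) ^ 2 := by
    rw [hs]
    exact pow_le_pow_left₀ hs0.le (by rw [hma]; linarith) 2
  have hcont : Continuous fun t : ℝ => t ^ (p / 2) - (m - 1) * t ^ ((p - 1) / 2) :=
    (Real.continuous_rpow_const (by linarith)).sub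
      (continuous_const.mul (Real.continuous_rpow_const (by linarith)))
  obtain ⟨x, hx, hxe⟩ := intermediate_value_Icc hab hcont.continuousOn
    (show -(lam * (p - 1) ^ (p - 1)) ∈ _ from
      ⟨hleft.le.trans (neg_le_neg (mul_le_mul_of_nonneg_right hle hq.le)),
        (neg_nonpos.2 (mul_pos hlam hq).le).trans hright.ge⟩)
  refine ⟨x, ⟨hx.1, eq_neg_iff_add_eq_zero.1 hxe⟩, fun y hy => ?_⟩
  exact hmono.injOn hy.1 hx.1 ((eq_neg_of_add_eq_zero_left hy.2).trans hxe.symm)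
end

section
/- Let n ≥ 2 be an integer, m > n and p real numbers, U a real symmetric n×n matrix, and T, F real numbers such that (p−1)U₁₁ + Σ_{i=2}^n U_{ii} = T + F. Then Σ_{i,j=1}^n U_{ij}² ≥ Σ_{i=1}^n U_{1i}² + (T − (p−1)U₁₁)²/(m−1) − F²/(m−n). -/
/-- The two-term Engel form of the Cauchy–Schwarz inequality, for a difference. -/
theorem sub_sq_div_add_le {a b : ℝ} (ha : 0 < a) (hb : 0 < b) (x y : ℝ) :
    (x - y) ^ 2 / (a + b) ≤ x ^ 2 / a + y ^ 2 / b := by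
  rw [div_add_div _ _ ha.ne' hb.ne', div_le_div_iff₀ (by positivity) (by positivity)]
  nlinarith [sq_nonneg (b * x + a * y)]

/-- The squares of the entries outside a given row dominate the squared partial trace. -/
theorem sq_sum_diag_erase_le {ι : Type*} [Fintype ι] [DecidableEq ι] (U : Matrix ι ι ℝ) (k : ι) :
    (∑ i ∈ Finset.univ.erase k, U i i) ^ 2 ≤
      ((Fintype.card ι : ℝ) - 1) * ∑ i ∈ Finset.univ.erase k, ∑ j, U i j ^ 2 := by
  have hcard : ((Finset.univ.erase k).card : ℝ) = (Fintype.card ι : ℝ) - 1 := by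
    rw [Finset.cast_card_erase_of_mem (Finset.mem_univ k), Finset.card_univ]
  rw [← hcard]
  refine sq_sum_le_card_mul_sum_sq.trans ?_
  gcongr with i
  exact Finset.single_le_sum (f := fun j => U i j ^ 2) (fun j _ => sq_nonneg _)
    (Finset.mem_univ i)

/-- Key pointwise Hessian estimate: if `U` is a real symmetric `n×n` matrix (`n ≥ 2`),
`m > n`, and `(p-1)U₁₁ + Σ_{i=2}^n U_{ii} = T + F`, then
`Σ_{i,j} U_{ij}² ≥ Σ_i U_{1i}² + (T - (p-1)U₁₁)²/(m-1) - F²/(m-n)`. -/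
theorem hessian_trace_estimate (n : ℕ) (hn : 2 ≤ n) (m p : ℝ) (hm : (n : ℝ) < m)
    (U : Matrix (Fin n) (Fin n) ℝ) (hU : U.IsSymm) (T F : ℝ)
    (htrace : (p - 1) * U ⟨0, by omega⟩ ⟨0, by omega⟩ +
        ∑ i ∈ Finset.univ.filter (fun i : Fin n => i ≠ ⟨0, by omega⟩), U i i = T + F) :
    ∑ i : Fin n, (U ⟨0, by omega⟩ i) ^ 2 +
        (T - (p - 1) * U ⟨0, by omega⟩ ⟨0, by omega⟩) ^ 2 / (m - 1) -
        F ^ 2 / (m - n) ≤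
      ∑ i : Fin n, ∑ j : Fin n, (U i j) ^ 2 := by
  have hn' : (2 : ℝ) ≤ n := by exact_mod_cast hn
  rw [Finset.filter_ne'] at htrace
  have hdiag := sq_sum_diag_erase_le U ⟨0, by omega⟩
  rw [Fintype.card_fin, ← div_le_iff₀' (by linarith)] at hdiag
  have hsplit := sub_sq_div_add_le (a := (n : ℝ) - 1) (b := m - n) (by linarith) (by linarith)
    (∑ i ∈ Finset.univ.erase (⟨0, by omega⟩ : Fin n), U i i) F
  rw [show (n : ℝ) - 1 + (m - n) = m - 1 by ring,
    show ∑ i ∈ Finset.univ.erase (⟨0, by omega⟩ : Fin n), U i i - F =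
      T - (p - 1) * U ⟨0, by omega⟩ ⟨0, by omega⟩ by linarith] at hsplit
  rw [← Finset.add_sum_erase _ (fun i => ∑ j, U i j ^ 2)
    (Finset.mem_univ (⟨0, by omega⟩ : Fin n))]
  linarith
end

section
/- Barta-type lower bound via the Picone identity, Euclidean case: let Ω ⊆ ℝ^n be open, f : Ω → ℝ smooth, p > 1 and λ real, and let v : Ω → ℝ be a smooth positive function such that the vector field e^{−f}|∇v|^{p−2}∇v is continuously differentiable on Ω and div(e^{−f}|∇v|^{p−2}∇v) ≤ −λ v^{p−1} e^{−f} on Ω. Then for every nonnegative smooth function φ with compact support in Ω, λ·∫_Ω φ^p e^{−f} dx ≤ ∫_Ω |∇φ|^p e^{−f} dx. -/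
open MeasureTheory

/-- Euclidean divergence of a vector field on `ℝⁿ`: the trace of its derivative. -/
noncomputable def ediv {n : ℕ}
    (F : EuclideanSpace ℝ (Fin n) → EuclideanSpace ℝ (Fin n))
    (x : EuclideanSpace ℝ (Fin n)) : ℝ :=
  ∑ i, fderiv ℝ F x (EuclideanSpace.single i 1) i

/-- Weighted Young inequality in the form used for Picone's identity. -/
lemma mul_rpow_sub_one_le {p a b : ℝ} (hp : 1 < p) (ha : 0 ≤ a) (hb : 0 ≤ b) :
    p * a * b ^ (p - 1) ≤ a ^ p + (p - 1) * b ^ p := by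
  have hp0 : 0 < p := by linarith
  have h := Real.geom_mean_le_arith_mean2_weighted (w₁ := 1 / p) (w₂ := (p - 1) / p)
    (by positivity) (div_nonneg (by linarith) hp0.le)
    (Real.rpow_nonneg ha p) (Real.rpow_nonneg hb p) (by field_simp; ring)
  rw [← Real.rpow_mul ha, ← Real.rpow_mul hb, mul_one_div_cancel hp0.ne', Real.rpow_one,
    mul_div_cancel₀ _ hp0.ne'] at h
  calc p * a * b ^ (p - 1) = p * (a * b ^ (p - 1)) := by ring
    _ ≤ p * (1 / p * a ^ p + (p - 1) / p * b ^ p) := by gcongr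
    _ = a ^ p + (p - 1) * b ^ p := by field_simp

/-- Pointwise Picone inequality for the `p`-Laplacian. -/
lemma picone_inequality {E : Type*} [NormedAddCommGroup E] [InnerProductSpace ℝ E]
    {p s t : ℝ} (hp : 1 < p) (hs : 0 ≤ s) (ht : 0 < t) (X Y : E) :
    ‖Y‖ ^ (p - 2) * (s ^ p * ((1 - p) * t ^ (1 - p - 1) * inner ℝ Y Y)
      + t ^ (1 - p) * (p * s ^ (p - 1) * inner ℝ X Y)) ≤ ‖X‖ ^ p := by
  rcases eq_or_ne Y 0 with rfl | hY
  · simp only [inner_zero_right, mul_zero, add_zero]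
    positivity
  have hY0 : 0 < ‖Y‖ := norm_pos_iff.2 hY
  have young := mul_rpow_sub_one_le hp (norm_nonneg X)
    (show 0 ≤ s * (‖Y‖ / t) by positivity)
  have e₁ : (s * (‖Y‖ / t)) ^ (p - 1) = s ^ (p - 1) * (‖Y‖ ^ (p - 2) * ‖Y‖ * t ^ (1 - p)) := by
    rw [Real.mul_rpow hs (by positivity), Real.div_rpow hY0.le ht.le,
      show 1 - p = -(p - 1) by ring, Real.rpow_neg ht.le, ← Real.rpow_add_one hY0.ne',
      show p - 2 + 1 = p - 1 by ring, div_eq_mul_inv]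
  have e₂ : (s * (‖Y‖ / t)) ^ p = s ^ p * (‖Y‖ ^ (p - 2) * ‖Y‖ ^ 2 * t ^ (1 - p - 1)) := by
    rw [Real.mul_rpow hs (by positivity), Real.div_rpow hY0.le ht.le,
      show 1 - p - 1 = -p by ring, Real.rpow_neg ht.le, ← Real.rpow_add_natCast hY0.ne',
      show p - 2 + ((2 : ℕ) : ℝ) = p by push_cast; ring, div_eq_mul_inv]
  rw [e₁, e₂] at young
  have cs : ‖Y‖ ^ (p - 2) * t ^ (1 - p) * (p * s ^ (p - 1)) * inner ℝ X Y
      ≤ ‖Y‖ ^ (p - 2) * t ^ (1 - p) * (p * s ^ (p - 1)) * (‖X‖ * ‖Y‖) := by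
    have := real_inner_le_norm X Y
    have hp0 : 0 < p := by linarith
    gcongr
  rw [real_inner_self_eq_norm_sq]
  linarith

/-- The divergence of a product `ψ F`. -/
lemma ediv_smul {n : ℕ} {ψ : EuclideanSpace ℝ (Fin n) → ℝ}
    {F : EuclideanSpace ℝ (Fin n) → EuclideanSpace ℝ (Fin n)} {x : EuclideanSpace ℝ (Fin n)}
    (hψ : DifferentiableAt ℝ ψ x) (hF : DifferentiableAt ℝ F x) :
    ediv (fun y => ψ y • F y) x = fderiv ℝ ψ x (F x) + ψ x * ediv F x := by
  have key : fderiv ℝ ψ x (F x) = ∑ i, fderiv ℝ ψ x (EuclideanSpace.single i 1) * F x i := by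
    conv_lhs => rw [← (EuclideanSpace.basisFun (Fin n) ℝ).sum_repr (F x), map_sum]
    simp [mul_comm]
  rw [key, ediv, ediv, Finset.mul_sum, ← Finset.sum_add_distrib, fderiv_fun_smul hψ hF]
  refine Finset.sum_congr rfl fun i _ => ?_
  simp [add_comm]

/-- The directional derivative of a compactly supported `C¹` function has zero integral. -/
lemma integral_fderiv_apply_eq_zero {E : Type*} [NormedAddCommGroup E] [NormedSpace ℝ E]
    [FiniteDimensional ℝ E] [MeasurableSpace E] [BorelSpace E] (μ : Measure E)
    [μ.IsAddHaarMeasure] {h : E → ℝ} (hh : ContDiff ℝ 1 h) (hc : HasCompactSupport h) (w : E) :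
    ∫ x, fderiv ℝ h x w ∂μ = 0 := by
  have hi : Integrable (fun x => fderiv ℝ h x w) μ :=
    ((hh.continuous_fderiv one_ne_zero).clm_apply continuous_const).integrable_of_hasCompactSupport
      (hc.fderiv_apply ℝ w)
  have := integral_mul_fderiv_eq_neg_fderiv_mul_of_integrable (𝕜 := ℝ) (μ := μ) (f := fun _ => 1)
    (g := h) (v := w) (by simp) (by simpa using hi)
    (by simpa using hh.continuous.integrable_of_hasCompactSupport hc)
    (fun x _ => by fun_prop) (fun x _ => (hh.differentiable one_ne_zero) x)
  simpa using this

/-- The derivative of a vector field is computed coordinatewise. -/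
lemma fderiv_euclidean_apply {n : ℕ}
    {F : EuclideanSpace ℝ (Fin n) → EuclideanSpace ℝ (Fin n)} {x : EuclideanSpace ℝ (Fin n)}
    (hF : DifferentiableAt ℝ F x) (i : Fin n) (w : EuclideanSpace ℝ (Fin n)) :
    fderiv ℝ F x w i = fderiv ℝ (fun y => F y i) x w := by
  have := ((EuclideanSpace.proj (𝕜 := ℝ) i).hasFDerivAt.comp x hF.hasFDerivAt).fderiv
  exact (congrArg (fun L => L w) this).symm

/-- Divergence theorem for compactly supported `C¹` vector fields. -/
lemma integral_ediv_eq_zero {n : ℕ}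
    {F : EuclideanSpace ℝ (Fin n) → EuclideanSpace ℝ (Fin n)}
    (hF : ContDiff ℝ 1 F) (hc : HasCompactSupport F) :
    ∫ x, ediv F x = 0 := by
  have hFi (i : Fin n) : ContDiff ℝ 1 (fun y => F y i) := by fun_prop
  have hci (i : Fin n) : HasCompactSupport (fun y => F y i) :=
    hc.comp_left (g := fun z : EuclideanSpace ℝ (Fin n) => z i) rfl
  have e (x) : ediv F x = ∑ i, fderiv ℝ (fun y => F y i) x (EuclideanSpace.single i 1) :=
    Finset.sum_congr rfl fun i _ =>
      fderiv_euclidean_apply (hF.differentiable one_ne_zero x) i _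
  simp_rw [e]
  rw [integral_finsetSum]
  · exact Finset.sum_eq_zero fun i _ => integral_fderiv_apply_eq_zero volume (hFi i) (hci i) _
  · intro i _
    exact (((hFi i).continuous_fderiv one_ne_zero).clm_apply
      continuous_const).integrable_of_hasCompactSupport ((hci i).fderiv_apply ℝ _)

lemma ContDiff.continuous_ediv {n : ℕ}
    {F : EuclideanSpace ℝ (Fin n) → EuclideanSpace ℝ (Fin n)} (hF : ContDiff ℝ 1 F) :
    Continuous (ediv F) := by
  have := hF.continuous_fderiv one_ne_zero
  unfold ediv
  fun_prop

lemma ediv_eq_zero_of_notMem_tsupport {n : ℕ}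
    {F : EuclideanSpace ℝ (Fin n) → EuclideanSpace ℝ (Fin n)} {x : EuclideanSpace ℝ (Fin n)}
    (hx : x ∉ tsupport F) : ediv F x = 0 := by
  have : fderiv ℝ F x = 0 := by
    by_contra h
    exact hx (support_fderiv_subset ℝ h)
  simp [ediv, this]

/-- Barta-type lower bound via the Picone identity, Euclidean case: if `v > 0` is a
smooth function on an open `Ω ⊆ ℝⁿ` such that the vector field `e^{-f}|∇v|^(p-2)∇v`
is `C¹` on `Ω` and `div(e^{-f}|∇v|^(p-2)∇v) ≤ -λ v^(p-1) e^{-f}` on `Ω`, then for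
every nonnegative smooth `φ` compactly supported in `Ω`,
`λ ∫_Ω φ^p e^{-f} ≤ ∫_Ω |∇φ|^p e^{-f}`. -/
theorem barta_lower_bound_weighted_pLaplacian {n : ℕ}
    (Ω : Set (EuclideanSpace ℝ (Fin n))) (hΩ : IsOpen Ω)
    (f v : EuclideanSpace ℝ (Fin n) → ℝ)
    (hf : ContDiffOn ℝ (⊤ : ℕ∞) f Ω) (hv : ContDiffOn ℝ (⊤ : ℕ∞) v Ω)
    (p lam : ℝ) (hp : 1 < p)
    (hvpos : ∀ x ∈ Ω, 0 < v x)
    (hG : ContDiffOn ℝ 1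
      (fun y => Real.exp (-f y) • ‖gradient v y‖ ^ (p - 2) • gradient v y) Ω)
    (hsuper : ∀ x ∈ Ω,
      ediv (fun y => Real.exp (-f y) • ‖gradient v y‖ ^ (p - 2) • gradient v y) x
        ≤ -lam * v x ^ (p - 1) * Real.exp (-f x)) :
    ∀ φ : EuclideanSpace ℝ (Fin n) → ℝ,
      ContDiff ℝ (⊤ : ℕ∞) φ → HasCompactSupport φ → tsupport φ ⊆ Ω →
      (∀ x, 0 ≤ φ x) →
      lam * ∫ x in Ω, φ x ^ p * Real.exp (-f x) ≤
        ∫ x in Ω, ‖gradient φ x‖ ^ p * Real.exp (-f x) := by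
  intro φ hφ hc hK hφ0
  have hp0 : 0 < p := by linarith
  set G : EuclideanSpace ℝ (Fin n) → EuclideanSpace ℝ (Fin n) :=
    fun y => Real.exp (-f y) • ‖gradient v y‖ ^ (p - 2) • gradient v y with hGdef
  set ψ : EuclideanSpace ℝ (Fin n) → ℝ := fun y => φ y ^ p * v y ^ (1 - p) with hψdef
  have hψ (x) (hx : x ∈ Ω) : ContDiffAt ℝ 1 ψ x := by
    have h₁ : ContDiffAt ℝ 1 φ x := hφ.contDiffAt.of_le (by simp)
    have h₂ : ContDiffAt ℝ 1 v x := (hv.contDiffAt (hΩ.mem_nhds hx)).of_le (by simp)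
    exact (h₁.rpow_const_of_le (m := 1) (by simpa using hp.le)).mul
      (h₂.rpow_const_of_ne (hvpos x hx).ne')
  have hGat (x) (hx : x ∈ Ω) : ContDiffAt ℝ 1 G x := hG.contDiffAt (hΩ.mem_nhds hx)
  have hψ_zero (x) (hx : φ x = 0) : ψ x = 0 := by simp [hψdef, hx, hp0.ne']
  have hsupp : tsupport (fun y => ψ y • G y) ⊆ tsupport φ := by
    refine closure_mono fun x hx => ?_
    by_contra h
    exact hx (by simp [hψ_zero x (Function.notMem_support.1 h)])
  have hcH : HasCompactSupport (fun y => ψ y • G y) :=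
    hc.of_isClosed_subset (isClosed_tsupport _) hsupp
  have hH : ContDiff ℝ 1 (fun y => ψ y • G y) :=
    contDiff_iff_contDiffAt.2 fun x => by
      by_cases hx : x ∈ tsupport (fun y => ψ y • G y)
      · exact (hψ x (hK (hsupp hx))).smul (hGat x (hK (hsupp hx)))
      · exact contDiffAt_const.congr_of_eventuallyEq (notMem_tsupport_iff_eventuallyEq.1 hx)
  have hpoint (x) (hx : x ∈ tsupport φ) : ediv (fun y => ψ y • G y) x ≤
      ‖gradient φ x‖ ^ p * Real.exp (-f x) - lam * (φ x ^ p * Real.exp (-f x)) := by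
    have hxΩ := hK hx
    have hvx := hvpos x hxΩ
    rw [ediv_smul ((hψ x hxΩ).differentiableAt one_ne_zero)
      ((hGat x hxΩ).differentiableAt one_ne_zero)]
    have hφd : HasFDerivAt φ (fderiv ℝ φ x) x :=
      (hφ.differentiable (by simp) x).hasFDerivAt
    have hvd : HasFDerivAt v (fderiv ℝ v x) x :=
      ((hv.contDiffAt (hΩ.mem_nhds hxΩ)).differentiableAt (by simp)).hasFDerivAt
    have hψd : fderiv ℝ ψ x = _ :=
      ((hφd.rpow_const (p := p) (Or.inr hp.le)).mul
        (hvd.rpow_const (p := 1 - p) (Or.inl hvx.ne'))).fderiv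
    have h₁ : fderiv ℝ ψ x (G x) ≤ ‖gradient φ x‖ ^ p * Real.exp (-f x) := by
      have pic := picone_inequality hp (hφ0 x) hvx (gradient φ x) (gradient v x)
      rw [inner_gradient_left, inner_gradient_left] at pic
      have := mul_le_mul_of_nonneg_right pic (Real.exp_pos (-f x)).le
      refine le_trans (le_of_eq ?_) this
      rw [hψd]
      simp only [hGdef, map_smul, add_apply, smul_apply, smul_eq_mul]
      ring
    have h₂ : ψ x * ediv G x ≤ -(lam * (φ x ^ p * Real.exp (-f x))) := by
      have hψ0 : 0 ≤ ψ x := mul_nonneg (Real.rpow_nonneg (hφ0 x) _) (Real.rpow_nonneg hvx.le _)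
      refine (mul_le_mul_of_nonneg_left (hsuper x hxΩ) hψ0).trans (le_of_eq ?_)
      have hv1 : v x ^ (1 - p) * v x ^ (p - 1) = 1 := by
        rw [← Real.rpow_add hvx]; simp
      calc ψ x * (-lam * v x ^ (p - 1) * Real.exp (-f x))
          = -(lam * (φ x ^ p * Real.exp (-f x))) * (v x ^ (1 - p) * v x ^ (p - 1)) := by
            simp only [hψdef]; ring
        _ = _ := by rw [hv1, mul_one]
    linarith
  have hexp : ContinuousOn (fun x => Real.exp (-f x)) (tsupport φ) :=
    (hf.continuousOn.mono hK).neg.rexp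
  have hgrad : Continuous (gradient φ) :=
    (InnerProductSpace.toDual ℝ _).symm.continuous.comp (hφ.continuous_fderiv (by simp))
  have i₁ : IntegrableOn (fun x => φ x ^ p * Real.exp (-f x)) (tsupport φ) :=
    ((hφ.continuous.rpow_const fun _ => Or.inr hp0.le).continuousOn.mul hexp).integrableOn_compact hc
  have i₂ : IntegrableOn (fun x => ‖gradient φ x‖ ^ p * Real.exp (-f x)) (tsupport φ) :=
    ((hgrad.norm.rpow_const fun _ => Or.inr hp0.le).continuousOn.mul hexp).integrableOn_compact hc
  have r₁ : ∫ x in Ω, φ x ^ p * Real.exp (-f x) =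
      ∫ x in tsupport φ, φ x ^ p * Real.exp (-f x) :=
    (setIntegral_eq_of_subset_of_forall_sdiff_eq_zero hΩ.measurableSet hK fun x hx => by
      simp [image_eq_zero_of_notMem_tsupport hx.2, hp0.ne'])
  have r₂ : ∫ x in Ω, ‖gradient φ x‖ ^ p * Real.exp (-f x) =
      ∫ x in tsupport φ, ‖gradient φ x‖ ^ p * Real.exp (-f x) :=
    (setIntegral_eq_of_subset_of_forall_sdiff_eq_zero hΩ.measurableSet hK fun x hx => by
      have : fderiv ℝ φ x = 0 := by
        by_contra h
        exact hx.2 (support_fderiv_subset ℝ h)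
      simp [gradient, this, hp0.ne'])
  have r₃ : ∫ x in tsupport φ, ediv (fun y => ψ y • G y) x = 0 := by
    rw [setIntegral_eq_integral_of_forall_compl_eq_zero, integral_ediv_eq_zero hH hcH]
    exact fun x hx => ediv_eq_zero_of_notMem_tsupport fun h => hx (hsupp h)
  have hmono := setIntegral_mono_on
    (hH.continuous_ediv.continuousOn.integrableOn_compact hc) (i₂.sub (i₁.const_mul lam))
    (isClosed_tsupport φ).measurableSet hpoint
  simp only [Pi.sub_apply] at hmono
  rw [r₃, integral_sub i₂ (i₁.const_mul lam), integral_const_mul] at hmono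
  rw [r₁, r₂]
  linarith
end

section
/- Let p > 1 and a > 0 be real numbers, and let x > 0 be a real number such that either (i) 1 < p < 2 and 0 < x ≤ a, or (ii) p ≥ 2 and a·√((p−2)/(p−1)) ≤ x ≤ a. Then −a²x^{p−2} + ((p−1)/p)·x^p ≤ −a^p/p. -/
theorem hasDerivAt_soliton_profile (p a : ℝ) (hp : p ≠ 0) {y : ℝ} (hy : 0 < y) :
    HasDerivAt (fun y : ℝ => -a ^ 2 * y ^ (p - 2) + (p - 1) / p * y ^ p)
      (y ^ (p - 3) * ((p - 1) * y ^ 2 - (p - 2) * a ^ 2)) y := by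
  have h₁ := (Real.hasDerivAt_rpow_const (p := p - 2) (Or.inl hy.ne')).const_mul (-a ^ 2)
  have h₂ := (Real.hasDerivAt_rpow_const (p := p) (Or.inl hy.ne')).const_mul ((p - 1) / p)
  refine (h₁.add h₂).congr_deriv ?_
  have e : y ^ (p - 1) = y ^ (p - 3) * y ^ 2 := by
    rw [← Real.rpow_natCast y 2, ← Real.rpow_add hy]
    congr 1
    push_cast
    ring
  rw [e, show p - 2 - 1 = p - 3 by ring]
  field_simp
  ring

theorem monotoneOn_soliton_profile {p a x : ℝ} (hp : 1 < p) (hx : 0 < x)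
    (h : (p - 2) * a ^ 2 ≤ (p - 1) * x ^ 2) :
    MonotoneOn (fun y : ℝ => -a ^ 2 * y ^ (p - 2) + (p - 1) / p * y ^ p) (Set.Ici x) := by
  have hd (y : ℝ) (hy : x ≤ y) :=
    hasDerivAt_soliton_profile p a (by positivity) (hx.trans_le hy)
  refine monotoneOn_of_hasDerivWithinAt_nonneg (convex_Ici x)
    (fun y hy => (hd y hy).continuousAt.continuousWithinAt)
    (fun y hy => (hd y (interior_subset hy)).hasDerivWithinAt) fun y hy => ?_
  have hxy : x ≤ y := interior_subset hy
  have hsq : x ^ 2 ≤ y ^ 2 := by gcongr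
  have := mul_le_mul_of_nonneg_left hsq (sub_nonneg.2 hp.le)
  exact mul_nonneg (Real.rpow_nonneg (hx.le.trans hxy) _) (by linarith)

/-- Elementary inequality from Theorem 5.3 of the paper: for `p > 1`, `a > 0` and
`x > 0` with either `1 < p < 2` and `x ≤ a`, or `p ≥ 2` and
`a√((p-2)/(p-1)) ≤ x ≤ a`, one has `-a²x^(p-2) + ((p-1)/p)x^p ≤ -a^p/p`. -/
theorem steady_soliton_inequality (p a x : ℝ) (hp : 1 < p) (ha : 0 < a) (hx : 0 < x)
    (h : (1 < p ∧ p < 2 ∧ x ≤ a) ∨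
         (2 ≤ p ∧ a * Real.sqrt ((p - 2) / (p - 1)) ≤ x ∧ x ≤ a)) :
    -a ^ 2 * x ^ (p - 2) + (p - 1) / p * x ^ p ≤ -(a ^ p) / p := by
  have hp₁ : 0 < p - 1 := sub_pos.2 hp
  have hxa : x ≤ a := by
    rcases h with h | h
    exacts [h.2.2, h.2.2]
  have key : (p - 2) * a ^ 2 ≤ (p - 1) * x ^ 2 := by
    rcases h with ⟨-, hp₂, -⟩ | ⟨hp₂, hax, -⟩
    · exact (mul_nonpos_of_nonpos_of_nonneg (by linarith) (sq_nonneg a)).trans (by positivity)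
    · have hsq := pow_le_pow_left₀ (by positivity) hax 2
      rw [mul_pow, Real.sq_sqrt (div_nonneg (by linarith) hp₁.le)] at hsq
      calc (p - 2) * a ^ 2 = (p - 1) * (a ^ 2 * ((p - 2) / (p - 1))) := by field_simp
        _ ≤ (p - 1) * x ^ 2 := by gcongr
  refine (monotoneOn_soliton_profile hp hx key Set.self_mem_Ici hxa hxa).trans_eq ?_
  have e : a ^ p = a ^ 2 * a ^ (p - 2) := by
    rw [← Real.rpow_natCast a 2, ← Real.rpow_add ha]
    congr 1
    push_cast
    ring
  simp only [e]
  field_simp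
  ring
end

section
/- Let m > 1, p > 1 and a > 0 be real numbers. On ℝ, let f(t) = −(m−1)t and v(t) = e^{−at}. Then for every t ∈ ℝ, d/dt(e^{−f(t)}·|v'(t)|^{p−2}·v'(t)) = −(m−1−(p−1)a)·a^{p−1}·e^{−f(t)}·v(t)^{p−1}; that is, v is a weighted p-eigenfunction on (ℝ, e^{−f}dt) with eigenvalue λ = (m−1−(p−1)a)·a^{p−1}, and |v'/v| = a. Equivalently, a satisfies (p−1)a^p − (m−1)a^{p−1} + λ = 0. -/
/-- The derivative of `t ↦ exp (c * t)` as a function. -/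
theorem deriv_exp_const_mul (c : ℝ) :
    deriv (fun r : ℝ => Real.exp (c * r)) = fun t => c * Real.exp (c * t) := by
  funext t
  simpa [mul_comm] using ((hasDerivAt_id t).const_mul c).exp.deriv

/-- The weighted flux `e^{kt} |v'|^(p-2) v'` of `v(t) = e^{-at}` is a single exponential. -/
theorem weighted_flux_exp (k p a t : ℝ) (ha : 0 < a) :
    Real.exp (-(-k * t)) * |-a * Real.exp (-a * t)| ^ (p - 2) * (-a * Real.exp (-a * t))
      = -a ^ (p - 1) * Real.exp ((k - (p - 1) * a) * t) := by
  have habs : |-a * Real.exp (-a * t)| = a * Real.exp (-a * t) := by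
    rw [abs_mul, abs_neg, abs_of_pos ha, Real.abs_exp]
  have hpow : a ^ (p - 1) = a ^ (p - 2) * a := by
    rw [← Real.rpow_add_one ha.ne']
    ring_nf
  have hexp : Real.exp ((k - (p - 1) * a) * t)
      = Real.exp (-(-k * t)) * Real.exp (-a * t * (p - 2)) * Real.exp (-a * t) := by
    rw [← Real.exp_add, ← Real.exp_add]
    ring_nf
  rw [habs, Real.mul_rpow ha.le (Real.exp_pos _).le, ← Real.exp_mul, hpow, hexp]
  ring

/-- One-dimensional reduction of Example 1.1 of the paper: on `ℝ` with weight
`f(t) = -(m-1)t`, the function `v(t) = e^{-at}` satisfies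
`(e^{-f}|v'|^(p-2)v')' = -(m-1-(p-1)a) a^(p-1) e^{-f} v^(p-1)`, i.e. `v` is a
weighted `p`-eigenfunction with eigenvalue `λ = (m-1-(p-1)a)a^(p-1)`; moreover
`|v'/v| = a`, and equivalently `(p-1)a^p - (m-1)a^(p-1) + λ = 0`. -/
theorem one_dimensional_eigenfunction_example (m p a : ℝ)
    (hm : 1 < m) (hp : 1 < p) (ha : 0 < a) :
    (∀ t : ℝ,
      deriv (fun s : ℝ =>
          Real.exp (-(-(m - 1) * s)) *
            |deriv (fun r : ℝ => Real.exp (-a * r)) s| ^ (p - 2) *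
            deriv (fun r : ℝ => Real.exp (-a * r)) s) t
        = -((m - 1 - (p - 1) * a) * a ^ (p - 1)) * Real.exp (-(-(m - 1) * t)) *
            Real.exp (-a * t) ^ (p - 1)) ∧
    (∀ t : ℝ, |deriv (fun r : ℝ => Real.exp (-a * r)) t / Real.exp (-a * t)| = a) ∧
    (p - 1) * a ^ p - (m - 1) * a ^ (p - 1) +
        (m - 1 - (p - 1) * a) * a ^ (p - 1) = 0 := by
  simp only [deriv_exp_const_mul]
  refine ⟨fun t => ?_, fun t => ?_, ?_⟩
  · simp only [weighted_flux_exp (m - 1) p a _ ha]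
    have hexp : Real.exp ((m - 1 - (p - 1) * a) * t)
        = Real.exp (-(-(m - 1) * t)) * Real.exp (-a * t) ^ (p - 1) := by
      rw [← Real.exp_mul, ← Real.exp_add]
      ring_nf
    simp only [deriv_const_mul_field, deriv_exp_const_mul, hexp]
    ring
  · rw [mul_div_cancel_right₀ _ (Real.exp_ne_zero _), abs_neg, abs_of_pos ha]
  · have hpow : a ^ p = a ^ (p - 1) * a := by
      rw [← Real.rpow_add_one ha.ne', sub_add_cancel]
    rw [hpow]
    ring
end
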